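/- arXiv:2412.10130 — 3 statements merged into one kernel-verified Lean document; each statement's English description precedes it below -/
import Mathlib

section
/- Let G = (V, E) be a finite connected graph with n ≥ 2 vertices and m ≥ 1 edges, and let ε, δ > 0. Set ρ = (√(ε + ln(1/δ)) − √(ln(1/δ)))² and ε' = √(2ρ/(n−1)). Then there exists a randomized mechanism M mapping each weight vector W ∈ ℝ^E to a probability distribution over spanning trees of G such that: (i) M is (ε, δ)-differentially private under ℓ∞-neighboring with sensitivity 1; and (ii) for every weight vector W, E[Σ_{e ∈ M(W)} w_e] − min_{T spanning tree of G} Σ_{e ∈ T} w_e ≤ (4(n−1)/ε') · ln(2em). -/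
/-- A spanning tree of the graph `G`: an acyclic set `T` of edges of `G` such that the graph
`(V, T)` is connected. -/
def IsSpanningTree {V : Type*} (G : SimpleGraph V) (T : Finset (Sym2 V)) : Prop :=
  ↑T ⊆ G.edgeSet ∧ (SimpleGraph.fromEdgeSet (↑T : Set (Sym2 V))).Connected ∧
    (SimpleGraph.fromEdgeSet (↑T : Set (Sym2 V))).IsAcyclic

open Finset

lemma sinh_le_mul_cosh {a : ℝ} (ha : 0 ≤ a) : Real.sinh a ≤ a * Real.cosh a := by
  have hm : MonotoneOn (fun x : ℝ => x * Real.cosh x - Real.sinh x) (Set.Ici 0) := by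
    apply monotoneOn_of_deriv_nonneg (convex_Ici 0)
    · fun_prop
    · fun_prop
    · intro x hx
      simp only [interior_Ici, Set.mem_Ioi] at hx
      have h : HasDerivAt (fun x : ℝ => x * Real.cosh x - Real.sinh x)
          (1 * Real.cosh x + x * Real.sinh x - Real.cosh x) x :=
        ((hasDerivAt_id x).mul (Real.hasDerivAt_cosh x)).sub (Real.hasDerivAt_sinh x)
      rw [h.deriv]
      have := Real.sinh_nonneg_iff.2 hx.le
      nlinarith [mul_nonneg hx.le this]
  have := hm (Set.mem_Ici.2 le_rfl) (Set.mem_Ici.2 ha) ha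
  simp at this
  exact this

lemma cosh_ratio {a b : ℝ} (hb : 0 ≤ b) (hab : b ≤ a) :
    Real.cosh a ≤ Real.exp ((a^2 - b^2)/2) * Real.cosh b := by
  have hm : AntitoneOn (fun x : ℝ => Real.cosh x * Real.exp (-(x^2/2))) (Set.Ici 0) := by
    apply antitoneOn_of_deriv_nonpos (convex_Ici 0)
    · fun_prop
    · fun_prop
    · intro x hx
      simp only [interior_Ici, Set.mem_Ioi] at hx
      have h0 : HasDerivAt (fun x : ℝ => -(x^2/2)) (-x) x := by
        have := ((hasDerivAt_pow 2 x).div_const 2).neg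
        exact this.congr_deriv (by simp)
      have h := (Real.hasDerivAt_cosh x).mul h0.exp
      have h' : deriv (fun x : ℝ => Real.cosh x * Real.exp (-(x^2/2))) x = _ := h.deriv
      rw [h']
      have := sinh_le_mul_cosh hx.le
      nlinarith [mul_nonneg (sub_nonneg.2 this) (Real.exp_pos (-(x^2/2))).le]
  have := hm (Set.mem_Ici.2 hb) (Set.mem_Ici.2 (hb.trans hab)) hab
  simp only at this
  have e1 : Real.exp ((a^2-b^2)/2) = Real.exp (a^2/2) * Real.exp (-(b^2/2)) := by
    rw [← Real.exp_add]; congr 1; ring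
  have e2 : Real.exp (a^2/2) * Real.exp (-(a^2/2)) = 1 := by
    rw [← Real.exp_add]; simp
  rw [e1]
  have := mul_le_mul_of_nonneg_left this (Real.exp_pos (a^2/2)).le
  calc Real.cosh a = Real.cosh a * (Real.exp (a^2/2) * Real.exp (-(a^2/2))) := by rw [e2, mul_one]
    _ ≤ _ := by linarith

/-- Moment bound for a pure DP step. -/
lemma moment_bound {ι : Type*} (s : Finset ι) (q r : ι → ℝ) (η t : ℝ) (hη : 0 < η) (ht : 0 ≤ t)
    (hq : ∀ i ∈ s, 0 ≤ q i) (hq1 : ∑ i ∈ s, q i = 1) (hqr : ∑ i ∈ s, q i * r i = 1)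
    (hr1 : ∀ i ∈ s, Real.exp (-η) ≤ r i) (hr2 : ∀ i ∈ s, r i ≤ Real.exp η) :
    ∑ i ∈ s, q i * r i ^ (1 + t) ≤ Real.exp (t * (1 + t) * η^2 / 2) := by
  set x := Real.exp η with hx
  set y := Real.exp (-η) with hy
  have hxy : y < x := Real.exp_lt_exp.2 (by linarith)
  have hy0 : 0 < y := Real.exp_pos _
  have hxy1 : x * y = 1 := by rw [hx, hy, ← Real.exp_add]; simp
  have hx1 : 1 < x := Real.one_lt_exp_iff.2 hη
  have hd : 0 < x - y := by linarith
  have hpt : ∀ i ∈ s, q i * r i ^ (1+t) ≤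
      (q i * x - q i * r i) / (x - y) * y ^ (1+t) + (q i * r i - q i * y) / (x - y) * x ^ (1+t) := by
    intro i hi
    have hc := (convexOn_rpow (p := 1 + t) (by linarith)).2 (Set.mem_Ici.2 hy0.le)
      (Set.mem_Ici.2 (hy0.trans hxy).le)
      (show 0 ≤ (x - r i) / (x - y) from div_nonneg (by linarith [hr2 i hi]) hd.le)
      (show 0 ≤ (r i - y) / (x - y) from div_nonneg (by linarith [hr1 i hi]) hd.le)
      (by field_simp; ring)
    simp only [smul_eq_mul] at hc
    have : (x - r i) / (x - y) * y + (r i - y) / (x - y) * x = r i := by field_simp; ring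
    rw [this] at hc
    calc _ ≤ _ := mul_le_mul_of_nonneg_left hc (hq i hi)
      _ = _ := by ring
  refine (sum_le_sum hpt).trans ?_
  rw [sum_add_distrib, ← sum_mul, ← sum_mul, ← sum_div, ← sum_div, sum_sub_distrib,
    sum_sub_distrib, ← sum_mul, ← sum_mul, hq1, hqr]
  have e1 : (1 * x - 1) / (x - y) = x / (x + 1) := by
    rw [div_eq_div_iff hd.ne' (by linarith)]; linear_combination hxy1
  have e2 : (1 - 1 * y) / (x - y) = 1 / (x + 1) := by
    rw [div_eq_div_iff hd.ne' (by linarith)]; linear_combination -hxy1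
  rw [e1, e2]
  have hc := cosh_ratio (a := (1/2 + t) * η) (b := η/2) (by positivity) (by nlinarith)
  have e3 : (((1/2 + t) * η)^2 - (η/2)^2)/2 = t * (1 + t) * η^2 / 2 := by ring
  rw [e3] at hc
  rw [Real.cosh_eq, Real.cosh_eq] at hc
  have hz : 0 < Real.exp (η/2) := Real.exp_pos _
  have f1 : y ^ (1 + t) * x = Real.exp (η/2) * Real.exp (-((1/2+t)*η)) := by
    rw [hy, hx, ← Real.exp_mul, ← Real.exp_add, ← Real.exp_add]; congr 1; ring
  have f2 : x ^ (1 + t) = Real.exp (η/2) * Real.exp (((1/2+t)*η)) := by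
    rw [hx, ← Real.exp_mul, ← Real.exp_add]; congr 1; ring
  have f3 : x + 1 = Real.exp (η/2) * (Real.exp (η/2) + Real.exp (-(η/2))) := by
    rw [mul_add, ← Real.exp_add, ← Real.exp_add]; simp [hx]
  have : x / (x + 1) * y ^ (1 + t) + 1 / (x + 1) * x ^ (1 + t)
      = (y ^ (1 + t) * x + x ^ (1 + t)) / (x + 1) := by ring
  rw [this, div_le_iff₀ (by linarith), f1, f2, f3]
  nlinarith [mul_le_mul_of_nonneg_left hc hz.le]

lemma isSpanningTree_iff {V : Type*} [Fintype V] (G : SimpleGraph V) (T : Finset (Sym2 V)) :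
    IsSpanningTree G T ↔ (↑T ⊆ G.edgeSet ∧
      (SimpleGraph.fromEdgeSet (↑T : Set (Sym2 V))).Connected ∧ T.card + 1 = Fintype.card V) := by
  unfold IsSpanningTree
  refine and_congr_right fun h => ?_
  rw [← SimpleGraph.isTree_iff, SimpleGraph.isTree_iff_connected_and_card,
    SimpleGraph.edgeSet_fromEdgeSet]
  have : (T : Set (Sym2 V)) \ Sym2.diagSet = T := by
    rw [sdiff_eq_left]
    refine Set.disjoint_left.2 fun e he hd => ?_
    exact G.not_isDiag_of_mem_edgeSet (h he) (by simpa using hd)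
  rw [this]
  simp

lemma exists_spanningTree {V : Type*} [Fintype V] (G : SimpleGraph V) (hG : G.Connected) :
    ∃ T, IsSpanningTree G T := by
  classical
  obtain ⟨T, hT, ht⟩ := hG.exists_isTree_le
  refine ⟨T.edgeFinset, ?_, ?_⟩
  · simpa using hT
  · simpa using ⟨ht.1, ht.2⟩

lemma spanningTree_exchange {V : Type*} [Fintype V] [DecidableEq V] (G : SimpleGraph V)
    {T T' : Finset (Sym2 V)} (hT : IsSpanningTree G T) (hT' : IsSpanningTree G T')
    {e : Sym2 V} (he' : e ∈ T') (he : e ∉ T) :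
    ∃ f ∈ T, f ∉ T' ∧ IsSpanningTree G (insert e (T.erase f)) := by
  have hTi := (isSpanningTree_iff G T).1 hT
  have heG : e ∈ G.edgeSet := hT'.1 he'
  induction e with | h x y
  have hxy : x ≠ y := G.ne_of_adj heG
  have hbr := SimpleGraph.isAcyclic_iff_forall_isBridge.1 hT'.2.2
    (show s(x, y) ∈ _ by simp [he', hxy])
  rw [SimpleGraph.isBridge_iff] at hbr
  obtain ⟨p, hp⟩ := hT.2.1.exists_isPath x y
  obtain ⟨d, hd, hd1, hd2⟩ := p.exists_boundary_dart
    {z | ((SimpleGraph.fromEdgeSet (↑T' : Set (Sym2 V))).deleteEdges {s(x, y)}).Reachable x z}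
    (by simp) (by simpa using hbr)
  obtain ⟨⟨a, b⟩, hab⟩ := d
  simp only [Set.mem_ofPred_eq] at hd1 hd2
  have habT : s(a, b) ∈ T ∧ a ≠ b := by simpa using hab
  have hfe : s(a, b) ≠ s(x, y) := fun h => he (h ▸ habT.1)
  have hfT' : s(a, b) ∉ T' := by
    intro h
    refine hd2 (hd1.trans (SimpleGraph.Adj.reachable ?_))
    rw [SimpleGraph.deleteEdges_adj]
    exact ⟨by simpa using ⟨h, habT.2⟩, by simpa using hfe⟩
  refine ⟨s(a, b), habT.1, hfT', (isSpanningTree_iff _ _).2 ⟨?_, ?_, ?_⟩⟩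
  · intro z hz
    simp only [coe_insert, coe_erase, Set.mem_insert_iff, Set.mem_sdiff, mem_coe] at hz
    rcases hz with rfl | hz
    · exact heG
    · exact hT.1 hz.1
  · set H := SimpleGraph.fromEdgeSet (↑(insert s(x, y) T) : Set (Sym2 V)) with hH
    have hle : SimpleGraph.fromEdgeSet (↑T : Set (Sym2 V)) ≤ H :=
      SimpleGraph.fromEdgeSet_mono (by simp)
    have hHc : H.Connected := hT.2.1.mono hle
    have hyx : H.Adj y x := by simp [hH, Sym2.eq_swap, hxy.symm]
    have hpf : s(a, b) ∈ p.edges := List.mem_map.2 ⟨_, hd, rfl⟩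
    have hcyc : (SimpleGraph.Walk.cons hyx (p.mapLe hle)).IsCycle := by
      rw [SimpleGraph.Walk.cons_isCycle_iff]
      refine ⟨hp.mapLe hle, fun h => ?_⟩
      have h2 : s(y, x) ∈ p.edges := by simpa using h
      have := p.edges_subset_edgeSet h2
      rw [Sym2.eq_swap] at this
      simp [he] at this
    have hnb : ¬ H.IsBridge s(a, b) := by
      intro h
      have hm : s(a, b) ∈ H.edgeSet := by simp [hH, habT]
      refine (SimpleGraph.isBridge_iff_forall_cycle_notMem hm).1 h _ hcyc ?_
      simp [hpf]
    refine (hHc.connected_delete_edge_of_not_isBridge hnb).mono ?_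
    intro u v huv
    simp only [hH, SimpleGraph.deleteEdges_adj, SimpleGraph.fromEdgeSet_adj, coe_insert,
      Set.mem_insert_iff, mem_coe, Set.mem_singleton_iff, coe_erase, Set.mem_sdiff] at huv ⊢
    tauto
  · rw [card_insert_of_notMem (by simp [he]), card_erase_of_mem habT.1]
    have := card_pos.2 ⟨_, habT.1⟩
    have := hTi.2.2
    omega

open Classical in
/-- Edges that may be added to the partial base `F`. -/
noncomputable def candSet {E : Type*} (A : Finset E) (B : Finset E → Prop) (F : Finset E) :
    Finset E :=
  A.filter (fun e => e ∉ F ∧ ∃ T, B T ∧ insert e F ⊆ T)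

/-- Exponential-mechanism step probability. -/
noncomputable def stepP {E : Type*} (C : Finset E) (β : ℝ) (W : E → ℝ) (e : E) : ℝ :=
  Real.exp (-(β * W e)) / ∑ i ∈ C, Real.exp (-(β * W i))

open Classical in
/-- Expectation of `φ` of the output after `k` further steps from state `F`. -/
noncomputable def mechE {E : Type*} (A : Finset E) (B : Finset E → Prop) (β : ℝ) (W : E → ℝ)
    (φ : Finset E → ℝ) : ℕ → Finset E → ℝ
  | 0, F => φ F
  | k + 1, F => ∑ e ∈ candSet A B F, stepP (candSet A B F) β W e * mechE A B β W φ k (insert e F)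

section
variable {E : Type*}

lemma stepP_nonneg (C : Finset E) (β : ℝ) (W : E → ℝ) (e : E) : 0 ≤ stepP C β W e :=
  div_nonneg (Real.exp_pos _).le (sum_nonneg fun _ _ => (Real.exp_pos _).le)

lemma stepZ_pos {C : Finset E} (hC : C.Nonempty) (β : ℝ) (W : E → ℝ) :
    0 < ∑ i ∈ C, Real.exp (-(β * W i)) := sum_pos (fun _ _ => Real.exp_pos _) hC

lemma stepP_sum {C : Finset E} (hC : C.Nonempty) (β : ℝ) (W : E → ℝ) :
    ∑ e ∈ C, stepP C β W e = 1 := by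
  unfold stepP
  rw [← sum_div, div_self (stepZ_pos hC β W).ne']

lemma stepP_pos {C : Finset E} (hC : C.Nonempty) (β : ℝ) (W : E → ℝ) (e : E) :
    0 < stepP C β W e := div_pos (Real.exp_pos _) (stepZ_pos hC β W)

lemma stepP_ratio {C : Finset E} (hC : C.Nonempty) {η : ℝ} (hη : 0 < η) (W W' : E → ℝ)
    (h : ∀ e ∈ C, |W e - W' e| ≤ 1) (e : E) (he : e ∈ C) :
    stepP C (η/2) W e ≤ Real.exp η * stepP C (η/2) W' e := by
  have key : ∀ (U U' : E → ℝ), (∀ e ∈ C, |U e - U' e| ≤ 1) → ∀ e ∈ C,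
      Real.exp (-(η/2 * U e)) ≤ Real.exp (η/2) * Real.exp (-(η/2 * U' e)) := by
    intro U U' hU e he
    rw [← Real.exp_add]
    apply Real.exp_le_exp.2
    have := (abs_le.1 (hU e he)).1
    nlinarith
  have h1 := key W W' h e he
  have h2 : ∑ i ∈ C, Real.exp (-(η/2 * W' i))
      ≤ Real.exp (η/2) * ∑ i ∈ C, Real.exp (-(η/2 * W i)) := by
    rw [mul_sum]
    exact sum_le_sum (key W' W (fun e he => by rw [abs_sub_comm]; exact h e he))
  have z1 := stepZ_pos hC (η/2) W
  have z2 := stepZ_pos hC (η/2) W'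
  unfold stepP
  rw [← mul_div_assoc, div_le_div_iff₀ z1 z2]
  have e1 : Real.exp η = Real.exp (η/2) * Real.exp (η/2) := by
    rw [← Real.exp_add]; congr 1; ring
  rw [e1]
  calc _ ≤ (Real.exp (η/2) * Real.exp (-(η/2 * W' e))) *
        (Real.exp (η/2) * ∑ i ∈ C, Real.exp (-(η/2 * W i))) :=
        mul_le_mul h1 h2 z2.le (by positivity)
    _ = _ := by ring

lemma mechE_privacy (A : Finset E) (B : Finset E → Prop) {η t : ℝ} (hη : 0 < η) (ht : 0 < t)
    (W W' : E → ℝ) (h : ∀ e ∈ A, |W e - W' e| ≤ 1) (φ : Finset E → ℝ)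
    (h0 : ∀ T, 0 ≤ φ T) (h1 : ∀ T, φ T ≤ 1) (k : ℕ) :
    ∀ (F : Finset E) (l : ℝ), 0 < l → mechE A B (η/2) W φ k F ≤
      l * mechE A B (η/2) W' φ k F + Real.exp (t * (1 + t) * η^2 / 2) ^ k * l ^ (-t) := by
  classical
  induction k with
  | zero =>
    intro F l hl
    simp only [mechE, pow_zero, one_mul]
    have hp : 0 < l ^ (-t) := Real.rpow_pos_of_pos hl _
    rcases le_total 1 l with hl1 | hl1
    · nlinarith [mul_nonneg (sub_nonneg.2 hl1) (h0 F)]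
    · have := Real.one_le_rpow_of_pos_of_le_one_of_nonpos hl hl1 (by linarith : -t ≤ 0)
      nlinarith [mul_nonneg hl.le (h0 F), h1 F]
  | succ k ih =>
    intro F l hl
    simp only [mechE]
    set C := candSet A B F with hCdef
    set c := Real.exp (t * (1 + t) * η^2 / 2) with hc
    have hcpos : 0 < c := Real.exp_pos _
    have hlt : 0 < l ^ (-t) := Real.rpow_pos_of_pos hl _
    rcases C.eq_empty_or_nonempty with hC | hC
    · rw [hC]; simp only [sum_empty, mul_zero, zero_add]; positivity
    have hAC : ∀ e ∈ C, |W e - W' e| ≤ 1 := fun e he => h e (by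
      rw [hCdef, candSet, mem_filter] at he; exact he.1)
    set p := stepP C (η/2) W with hp
    set q := stepP C (η/2) W' with hq
    have pp : ∀ e, 0 < p e := stepP_pos hC _ _
    have qp : ∀ e, 0 < q e := stepP_pos hC _ _
    have hmom := moment_bound C q (fun e => p e / q e) η t hη ht.le (fun e _ => (qp e).le)
      (stepP_sum hC _ _)
      (by rw [← stepP_sum hC (η/2) W]
          exact sum_congr rfl fun e _ => mul_div_cancel₀ _ (qp e).ne')
      (fun e he => by
        have := stepP_ratio hC hη W' W (fun e he => by rw [abs_sub_comm]; exact hAC e he) e he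
        rw [le_div_iff₀ (qp e), Real.exp_neg, inv_mul_le_iff₀ (Real.exp_pos _)]
        exact this)
      (fun e he => by
        rw [div_le_iff₀ (qp e)]
        exact stepP_ratio hC hη W W' hAC e he)
    have hstep : ∀ e ∈ C, p e * mechE A B (η/2) W φ k (insert e F) ≤
        l * (q e * mechE A B (η/2) W' φ k (insert e F))
          + c ^ k * l ^ (-t) * (q e * (p e / q e) ^ (1 + t)) := by
      intro e he
      have hr : 0 < p e / q e := div_pos (pp e) (qp e)
      have := mul_le_mul_of_nonneg_left (ih (insert e F) (l / (p e / q e)) (div_pos hl hr)) (pp e).le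
      refine this.trans (le_of_eq ?_)
      rw [Real.div_rpow hl.le hr.le, Real.rpow_neg hr.le, Real.rpow_add hr, Real.rpow_one]
      have := (pp e).ne'
      have := (qp e).ne'
      have := (Real.rpow_pos_of_pos hr t).ne'
      generalize (p e / q e) ^ t = z at *
      field_simp
    refine (sum_le_sum hstep).trans ?_
    rw [sum_add_distrib, ← mul_sum, ← mul_sum, pow_succ]
    have := mul_le_mul_of_nonneg_left hmom (show 0 ≤ c ^ k * l ^ (-t) by positivity)
    rw [mul_right_comm (c^k)]
    linarith

lemma mechE_linear [Fintype E] [DecidableEq E] (A : Finset E) (B : Finset E → Prop) (β : ℝ)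
    (W : E → ℝ) (φ : Finset E → ℝ) (k : ℕ) : ∀ F : Finset E,
    mechE A B β W φ k F = ∑ T, mechE A B β W (fun X => if X = T then 1 else 0) k F * φ T := by
  induction k with
  | zero => intro F; simp [mechE]
  | succ k ih =>
    intro F
    simp only [mechE]
    simp_rw [sum_mul]
    rw [sum_comm]
    refine sum_congr rfl fun e _ => ?_
    rw [ih, mul_sum]
    exact sum_congr rfl fun T _ => by ring

lemma mechE_nonneg (A : Finset E) (B : Finset E → Prop) (β : ℝ)
    (W : E → ℝ) (φ : Finset E → ℝ) (h : ∀ T, 0 ≤ φ T) (k : ℕ) : ∀ F : Finset E,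
    0 ≤ mechE A B β W φ k F := by
  induction k with
  | zero => intro F; exact h F
  | succ k ih =>
    intro F
    exact sum_nonneg fun e _ => mul_nonneg (stepP_nonneg _ _ _ _) (ih _)

/-- states from which some base is reachable -/
lemma candSet_nonempty {A : Finset E} {B : Finset E → Prop} {r : ℕ}
    (hA : ∀ T, B T → T ⊆ A) (hr : ∀ T, B T → T.card = r) {F T : Finset E} (hT : B T) (hF : F ⊆ T)
    {k : ℕ} (hk : F.card + (k + 1) = r) : (candSet A B F).Nonempty := by
  classical
  have : F ⊂ T := by
    refine lt_of_le_of_ne hF fun h => ?_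
    have := hr T hT
    rw [← h] at this; omega
  obtain ⟨e, he, heF⟩ := exists_of_ssubset this
  exact ⟨e, by
    rw [candSet, mem_filter]
    exact ⟨hA T hT he, heF, T, hT, by convert insert_subset he hF⟩⟩

lemma mechE_const {A : Finset E} {B : Finset E → Prop} {r : ℕ} (β : ℝ) (W : E → ℝ)
    (hA : ∀ T, B T → T ⊆ A) (hr : ∀ T, B T → T.card = r) (φ : Finset E → ℝ) (a : ℝ)
    (hφ : ∀ T, B T → φ T = a) (k : ℕ) :
    ∀ F : Finset E, F.card + k = r → (∃ T, B T ∧ F ⊆ T) → mechE A B β W φ k F = a := by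
  classical
  induction k with
  | zero =>
    rintro F hF ⟨T, hT, hFT⟩
    have : F = T := eq_of_subset_of_card_le hFT (by rw [hr T hT]; omega)
    exact hφ F (this ▸ hT)
  | succ k ih =>
    rintro F hF ⟨T, hT, hFT⟩
    have hne := candSet_nonempty hA hr hT hFT hF
    simp only [mechE]
    rw [sum_congr rfl (g := fun e => stepP (candSet A B F) β W e * a), ← sum_mul,
      stepP_sum hne, one_mul]
    intro e he
    rw [candSet, mem_filter] at he
    obtain ⟨_, heF, T', hT', hs⟩ := he
    congr 1
    refine ih _ ?_ ⟨T', hT', by convert hs⟩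
    rw [card_insert_of_notMem heF]; omega

lemma gibbs {C : Finset E} (hC : C.Nonempty) {β : ℝ} (hβ : 0 < β) (W : E → ℝ) (m : ℕ)
    (hm : C.card ≤ m) (w0 : ℝ) (hw0 : ∃ e ∈ C, W e = w0) :
    ∑ e ∈ C, stepP C β W e * (W e - w0) ≤ Real.log m / β := by
  have hm0 : 0 < (m : ℝ) := by exact_mod_cast (card_pos.2 hC).trans_le hm
  rw [le_div_iff₀ hβ]
  set Z := ∑ i ∈ C, Real.exp (-(β * W i)) with hZ
  have zp : 0 < Z := stepZ_pos hC β W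
  obtain ⟨e0, he0, rfl⟩ := hw0
  have hz1 : -(β * W e0) ≤ Real.log Z := by
    rw [Real.le_log_iff_exp_le zp]
    exact single_le_sum (f := fun i => Real.exp (-(β * W i))) (fun _ _ => (Real.exp_pos _).le) he0
  have hstep : ∀ e ∈ C, stepP C β W e * (W e - W e0) * β ≤
      stepP C β W e * (Real.log m - 1) + 1 / m := by
    intro e he
    have pp := stepP_pos hC β W e
    have hl : Real.log (stepP C β W e) = -(β * W e) - Real.log Z := by
      unfold stepP; rw [Real.log_div (Real.exp_pos _).ne' zp.ne', Real.log_exp]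
    have hlog := Real.one_sub_inv_le_log_of_pos (mul_pos pp hm0)
    rw [Real.log_mul pp.ne' hm0.ne', hl] at hlog
    have h1 : (W e - W e0) * β ≤ Real.log m - 1 + (stepP C β W e * m)⁻¹ := by nlinarith
    have := mul_le_mul_of_nonneg_left h1 pp.le
    calc _ = stepP C β W e * ((W e - W e0) * β) := by ring
      _ ≤ _ := this
      _ = _ := by field_simp
  rw [sum_mul]
  refine (sum_le_sum hstep).trans ?_
  rw [sum_add_distrib, ← sum_mul, stepP_sum hC, sum_const, nsmul_eq_mul]
  have : (C.card : ℝ) * (1 / m) ≤ 1 := by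
    rw [mul_one_div, div_le_one hm0]; exact_mod_cast hm
  linarith

lemma mechE_utility [DecidableEq E] {A : Finset E} {B : Finset E → Prop} {r : ℕ} {β : ℝ}
    (hβ : 0 < β) (W : E → ℝ)
    (hA : ∀ T, B T → T ⊆ A) (hr : ∀ T, B T → T.card = r)
    (hex : ∀ T T', B T → B T' → ∀ e ∈ T', e ∉ T → ∃ f ∈ T, f ∉ T' ∧ B (insert e (T.erase f)))
    (k : ℕ) :
    ∀ F T : Finset E, F.card + k = r → B T → F ⊆ T →
      mechE A B β W (fun X => ∑ e ∈ X, W e) k F ≤ ∑ e ∈ T, W e + k * (Real.log A.card / β) := by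
  induction k with
  | zero =>
    intro F T hF hT hFT
    have : F = T := eq_of_subset_of_card_le hFT (by rw [hr T hT]; omega)
    simp [mechE, this]
  | succ k ih =>
    intro F T hF hT hFT
    have hne := candSet_nonempty hA hr hT hFT hF
    have hcand : ∀ e, e ∈ candSet A B F ↔ e ∈ A ∧ e ∉ F ∧ ∃ T, B T ∧ insert e F ⊆ T := by
      intro e
      unfold candSet
      simp only [mem_filter]
      convert Iff.rfl
    obtain ⟨e0, he0, hmin⟩ := exists_min_image (candSet A B F) W hne
    have hstep : ∀ e ∈ candSet A B F,
        mechE A B β W (fun X => ∑ e ∈ X, W e) k (insert e F) ≤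
        (∑ e ∈ T, W e + k * (Real.log A.card / β)) + (W e - W e0) := by
      intro e he
      obtain ⟨heA, heF, T', hT', hs⟩ := (hcand e).1 he
      have hcard : (insert e F).card + k = r := by rw [card_insert_of_notMem heF]; omega
      by_cases heT : e ∈ T
      · have := ih (insert e F) T hcard hT (insert_subset heT hFT)
        linarith [hmin e he]
      · obtain ⟨f, hf, hfT', hB⟩ := hex T T' hT hT' e (hs (mem_insert_self _ _)) heT
        have hfF : f ∉ F := fun h => hfT' (hs (mem_insert_of_mem h))
        have hfc : f ∈ candSet A B F :=
          (hcand f).2 ⟨hA T hT hf, hfF, T, hT, insert_subset hf hFT⟩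
        have := ih (insert e F) _ hcard hB (insert_subset_insert _ (fun z hz =>
          mem_erase.2 ⟨fun h => hfF (h ▸ hz), hFT hz⟩))
        rw [sum_insert (by simp [heT])] at this
        have h2 := add_sum_erase T W hf
        linarith [hmin f hfc]
    have hg := gibbs hne hβ W A.card (card_le_card fun e he => ((hcand e).1 he).1) (W e0) ⟨e0, he0, rfl⟩
    simp only [mechE]
    calc _ ≤ ∑ e ∈ candSet A B F, stepP (candSet A B F) β W e *
            ((∑ e ∈ T, W e + k * (Real.log A.card / β)) + (W e - W e0)) := by
            refine sum_le_sum fun e he => mul_le_mul_of_nonneg_left ?_ (stepP_nonneg _ _ _ _)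
            refine le_of_eq_of_le ?_ (hstep e he)
            congr!
      _ = (∑ e ∈ T, W e + k * (Real.log A.card / β)) +
            ∑ e ∈ candSet A B F, stepP (candSet A B F) β W e * (W e - W e0) := by
            generalize ∑ e ∈ T, W e + k * (Real.log A.card / β) = z
            simp_rw [mul_add]
            rw [sum_add_distrib, ← sum_mul, stepP_sum hne, one_mul]
      _ ≤ _ := by push_cast; linarith
end

/-- Let `G = (V, E)` be a finite connected graph with `n ≥ 2` vertices and
`m ≥ 1` edges, `ε, δ > 0`, `ρ = (√(ε + ln(1/δ)) − √(ln(1/δ)))²`, and `ε' = √(2ρ/(n−1))`.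
There is a randomized mechanism `M` mapping each weight vector `W ∈ ℝ^E` to a distribution
over spanning trees of `G` such that (i) `M` is `(ε, δ)`-differentially private under
`ℓ∞`-neighboring with sensitivity `1`, and (ii) for every `W`,
`E[Σ_{e ∈ M(W)} w_e] − min_{T spanning tree} Σ_{e ∈ T} w_e ≤ (4(n−1)/ε')·ln(2em)`. -/
theorem stmt_0 {V : Type*} [Fintype V] [DecidableEq V]
    (G : SimpleGraph V) [Fintype G.edgeSet] (hG : G.Connected)
    (n m : ℕ) (hn : n = Fintype.card V) (hn2 : 2 ≤ n)
    (hm : m = G.edgeFinset.card) (hm1 : 1 ≤ m)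
    (ε δ ρ ε' : ℝ) (hε : 0 < ε) (hδ : 0 < δ)
    (hρ : ρ = (Real.sqrt (ε + Real.log (1 / δ)) - Real.sqrt (Real.log (1 / δ))) ^ 2)
    (hε' : ε' = Real.sqrt (2 * ρ / ((n : ℝ) - 1))) :
    ∃ M : (Sym2 V → ℝ) → PMF (Finset (Sym2 V)),
      -- M maps each weight vector to a distribution over spanning trees of G
      (∀ W : Sym2 V → ℝ, ∀ T ∈ (M W).support, IsSpanningTree G T) ∧
      -- (i) (ε, δ)-differential privacy under ℓ∞-neighboring with sensitivity 1
      (∀ W W' : Sym2 V → ℝ, (∀ e ∈ G.edgeSet, |W e - W' e| ≤ 1) →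
        ∀ S : Set (Finset (Sym2 V)),
          (M W).toOuterMeasure S
            ≤ ENNReal.ofReal (Real.exp ε) * (M W').toOuterMeasure S + ENNReal.ofReal δ) ∧
      -- (ii) utility: expected weight minus the optimum is at most (4(n−1)/ε')·ln(2em)
      (∀ W : Sym2 V → ℝ,
        (∑' T : Finset (Sym2 V), ((M W) T).toReal * ∑ e ∈ T, W e)
            - sInf {x : ℝ | ∃ T : Finset (Sym2 V), IsSpanningTree G T ∧ x = ∑ e ∈ T, W e}
          ≤ 4 * ((n : ℝ) - 1) / ε' * Real.log (2 * Real.exp 1 * m)) := by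
  classical
  set B : Finset (Sym2 V) → Prop := IsSpanningTree G with hB
  set r := n - 1 with hrdef
  have hrn : (r : ℝ) = (n : ℝ) - 1 := by rw [hrdef, Nat.cast_sub (by omega)]; simp
  have hr0 : 0 < (r : ℝ) := by exact_mod_cast (by omega : 0 < r)
  have hA : ∀ T, B T → T ⊆ G.edgeFinset := fun T hT e he => by
    rw [SimpleGraph.mem_edgeFinset]; exact hT.1 he
  have hr : ∀ T, B T → T.card = r := fun T hT => by
    have := ((isSpanningTree_iff G T).1 hT).2.2
    omega
  obtain ⟨T0, hT0⟩ := exists_spanningTree G hG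
  have hlogm : 0 ≤ Real.log m := Real.log_natCast_nonneg m
  have hm0 : (0 : ℝ) < m := by exact_mod_cast hm1
  have hlog2 : Real.log (2 * Real.exp 1 * m) = Real.log 2 + 1 + Real.log m := by
    rw [Real.log_mul (by positivity) hm0.ne', Real.log_mul (by norm_num) (Real.exp_pos _).ne',
      Real.log_exp]
  have hl2 : 0 ≤ Real.log 2 := Real.log_nonneg (by norm_num)
  -- the minimum is attained
  have hmin : ∀ W : Sym2 V → ℝ, ∃ T, B T ∧ ∑ e ∈ T, W e =
      sInf {x : ℝ | ∃ T : Finset (Sym2 V), B T ∧ x = ∑ e ∈ T, W e} := by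
    intro W
    have hfin : {x : ℝ | ∃ T : Finset (Sym2 V), B T ∧ x = ∑ e ∈ T, W e}.Finite := by
      refine (Set.finite_range (fun T : Finset (Sym2 V) => ∑ e ∈ T, W e)).subset ?_
      rintro x ⟨T, _, rfl⟩
      exact ⟨T, rfl⟩
    have hne : {x : ℝ | ∃ T : Finset (Sym2 V), B T ∧ x = ∑ e ∈ T, W e}.Nonempty :=
      ⟨_, T0, hT0, rfl⟩
    obtain ⟨T, hT, h⟩ := hne.csInf_mem hfin
    exact ⟨T, hT, h.symm⟩
  rcases le_or_gt 1 δ with hδ1 | hδ1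
  · -- trivial privacy regime
    choose f hf hf2 using hmin
    refine ⟨fun W => PMF.pure (f W), ?_, ?_, ?_⟩
    · intro W T hT
      rw [PMF.support_pure, Set.mem_singleton_iff] at hT
      exact hT ▸ hf W
    · intro W W' _ S
      refine le_trans ?_ le_add_self
      calc (PMF.pure (f W)).toOuterMeasure S ≤ 1 := by
            rw [PMF.toOuterMeasure_pure_apply]; split_ifs <;> simp
        _ ≤ _ := by rw [← ENNReal.ofReal_one]; exact ENNReal.ofReal_le_ofReal hδ1
    · intro W
      have : (∑' T : Finset (Sym2 V), ((PMF.pure (f W)) T).toReal * ∑ e ∈ T, W e)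
          = ∑ e ∈ f W, W e := by
        rw [tsum_eq_single (f W)]
        · simp
        · intro T hT; simp [PMF.pure_apply, hT]
      rw [this, hf2 W, sub_self, hlog2, ← hrn, hε']
      positivity
  -- main regime
  set L := Real.log (1 / δ) with hL
  have hLpos : 0 < L := Real.log_pos (by rw [lt_div_iff₀ hδ]; linarith)
  set s := Real.sqrt (ε + L) - Real.sqrt L with hs
  have hspos : 0 < s := sub_pos.2 (Real.sqrt_lt_sqrt hLpos.le (by linarith))
  have hseq : s ^ 2 + 2 * s * Real.sqrt L = ε := by
    have h1 := Real.sq_sqrt (show 0 ≤ ε + L by linarith)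
    have h2 := Real.sq_sqrt hLpos.le
    rw [hs]; linear_combination h1 - h2
  have hρpos : 0 < ρ := by rw [hρ]; positivity
  have hη : 0 < ε' := by rw [hε', ← hrn]; positivity
  have hηsq : r * ε' ^ 2 / 2 = s ^ 2 := by
    rw [hε', Real.sq_sqrt (by rw [← hrn]; positivity), ← hrn, hρ]; field_simp
  set t := Real.sqrt L / s with ht
  have htpos : 0 < t := div_pos (Real.sqrt_pos.2 hLpos) hspos
  have hts : t * s = Real.sqrt L := div_mul_cancel₀ _ hspos.ne'
  have hδeq : Real.exp (t * (1 + t) * ε' ^ 2 / 2) ^ r * Real.exp ε ^ (-t) = δ := by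
    rw [← Real.exp_nat_mul, ← Real.exp_mul, ← Real.exp_add]
    have : (r : ℝ) * (t * (1 + t) * ε' ^ 2 / 2) + ε * -t = -L := by
      have h2 := Real.sq_sqrt hLpos.le
      rw [← hts] at h2 hseq
      linear_combination (t * (1 + t)) * hηsq + t * hseq - h2
    rw [this, hL, one_div, Real.log_inv, neg_neg, Real.exp_log hδ]
  set A := G.edgeFinset with hAdef
  set P : (Sym2 V → ℝ) → Finset (Sym2 V) → ℝ :=
    fun W T => mechE A B (ε' / 2) W (fun X => if X = T then 1 else 0) r ∅ with hP
  have hP0 : ∀ W T, 0 ≤ P W T := fun W T =>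
    mechE_nonneg _ _ _ _ _ (fun X => by split_ifs <;> norm_num) _ _
  have hlin : ∀ W φ, ∑ T, P W T * φ T = mechE A B (ε' / 2) W φ r ∅ := fun W φ =>
    (mechE_linear A B (ε' / 2) W φ r ∅).symm
  have hstart : ∃ T, B T ∧ (∅ : Finset (Sym2 V)) ⊆ T := ⟨T0, hT0, empty_subset _⟩
  have hP1 : ∀ W, ∑ T, P W T = 1 := fun W => by
    have h := hlin W (fun _ => 1)
    simp only [mul_one] at h
    rw [h]
    exact mechE_const _ _ hA hr _ 1 (fun _ _ => rfl) _ _ (by simp) hstart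
  refine ⟨fun W => PMF.ofFintype (fun T => ENNReal.ofReal (P W T)) ?_, ?_, ?_, ?_⟩
  · rw [← ENNReal.ofReal_sum_of_nonneg (fun T _ => hP0 W T), hP1, ENNReal.ofReal_one]
  · intro W T hT
    by_contra hBT
    rw [PMF.mem_support_iff, PMF.ofFintype_apply] at hT
    apply hT
    have : P W T = 0 := by
      refine mechE_const _ _ hA hr _ 0 ?_ _ _ (by simp) hstart
      intro X hX
      refine if_neg ?_
      rintro rfl
      exact hBT hX
    rw [this, ENNReal.ofReal_zero]
  · intro W W' hWW S
    have hS : ∀ W, (PMF.ofFintype (fun T => ENNReal.ofReal (P W T)) (by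
        rw [← ENNReal.ofReal_sum_of_nonneg (fun T _ => hP0 W T), hP1,
          ENNReal.ofReal_one])).toOuterMeasure S
        = ENNReal.ofReal (mechE A B (ε' / 2) W (fun X => if X ∈ S then 1 else 0) r ∅) := by
      intro W
      rw [PMF.toOuterMeasure_apply_fintype, ← hlin W (fun X => if X ∈ S then 1 else 0)]
      refine Eq.trans ?_ (ENNReal.ofReal_sum_of_nonneg ?_).symm
      · refine sum_congr rfl fun T _ => ?_
        by_cases hT : T ∈ S <;> simp [hT]
      · intro T _
        exact mul_nonneg (hP0 W T) (by beta_reduce; split_ifs <;> norm_num)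
    rw [hS W, hS W', ← ENNReal.ofReal_mul (Real.exp_pos _).le, ← ENNReal.ofReal_add]
    · apply ENNReal.ofReal_le_ofReal
      have := mechE_privacy A B hη htpos W W'
        (fun e he => hWW e (by rwa [hAdef, SimpleGraph.mem_edgeFinset] at he))
        (fun X => if X ∈ S then 1 else 0)
        (fun X => by split_ifs <;> norm_num) (fun X => by split_ifs <;> norm_num) r ∅
        (Real.exp ε) (Real.exp_pos _)
      rwa [hδeq] at this
    · exact mul_nonneg (Real.exp_pos _).le
        (mechE_nonneg _ _ _ _ _ (fun X => by split_ifs <;> norm_num) _ _)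
    · exact hδ.le
  · intro W
    obtain ⟨T, hT, hTmin⟩ := hmin W
    rw [← hTmin, tsum_fintype]
    simp only [PMF.ofFintype_apply, ENNReal.toReal_ofReal (hP0 W _)]
    rw [hlin W (fun T => ∑ e ∈ T, W e)]
    have hu := mechE_utility (A := A) (B := B) (r := r) (half_pos hη) W hA hr
      (fun T T' hT hT' e he he' => spanningTree_exchange G hT hT' he he') r ∅ T (by simp) hT
      (empty_subset _)
    rw [← hm] at hu
    rw [hlog2, ← hrn]
    have h3 : (r : ℝ) * (Real.log m / (ε' / 2)) ≤ 4 * r / ε' * (Real.log 2 + 1 + Real.log m) := by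
      have : (r : ℝ) * (Real.log m / (ε' / 2)) = 4 * r / ε' * (Real.log m / 2) := by
        field_simp; ring
      rw [this]
      exact mul_le_mul_of_nonneg_left (by linarith) (by positivity)
    linarith
end

section
/- Let G = (V, E) be a finite connected graph with n ≥ 2 vertices, let ε, δ > 0, set ρ = (√(ε + ln(1/δ)) − √(ln(1/δ)))² and ε' = √(2ρ/(n−1)). Consider the randomized mechanism that, given a weight vector W ∈ ℝ^E, iterates n−1 times: starting from T = ∅ and candidate set F = E, in each round it samples an edge e ∈ F with probability proportional to exp(−(ε'/2)·w_e), adds e to T, and removes from F all edges e' such that T ∪ {e'} contains a cycle; finally it outputs T. This mechanism is (ε, δ)-differentially private under ℓ∞-neighboring with sensitivity 1. -/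
attribute [local instance] Classical.propDecidable

/-- The candidate set maintained by (private) Kruskal's algorithm: given the set `T` of edges
selected so far, the candidates are the edges of `G` not in `T` whose addition to `T` does not
create a cycle. -/
noncomputable def kruskalCand {V : Type*} [Fintype V] [DecidableEq V]
    (G : SimpleGraph V) [Fintype G.edgeSet] (T : Finset (Sym2 V)) : Finset (Sym2 V) :=
  G.edgeFinset.filter fun e' =>
    e' ∉ T ∧ (SimpleGraph.fromEdgeSet (↑(insert e' T) : Set (Sym2 V))).IsAcyclic

/-- `KruskalFeasible G T l` : starting from the already-selected edge set `T`, the sequence `l`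
of edges is a possible run of the iterative selection: each successive edge lies in the current
candidate set. -/
def KruskalFeasible {V : Type*} [Fintype V] [DecidableEq V]
    (G : SimpleGraph V) [Fintype G.edgeSet] : Finset (Sym2 V) → List (Sym2 V) → Prop
  | _, [] => True
  | T, e :: rest => e ∈ kruskalCand G T ∧ KruskalFeasible G (insert e T) rest

/-- The probability that private Kruskal, run with exponential-mechanism parameter `ε'` on the
weight vector `W` and starting from the already-selected edge set `T`, selects exactly the
sequence `l` of edges: at each round an edge `e` of the current candidate set `F` is sampled
with probability `exp(−(ε'/2)·w_e) / Σ_{e' ∈ F} exp(−(ε'/2)·w_{e'})`. -/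
noncomputable def kruskalSeqProb {V : Type*} [Fintype V] [DecidableEq V]
    (G : SimpleGraph V) [Fintype G.edgeSet] (ε' : ℝ) (W : Sym2 V → ℝ) :
    Finset (Sym2 V) → List (Sym2 V) → ℝ
  | _, [] => 1
  | T, e :: rest =>
      (Real.exp (-(ε' / 2) * W e) / ∑ e' ∈ kruskalCand G T, Real.exp (-(ε' / 2) * W e')) *
        kruskalSeqProb G ε' W (insert e T) rest

open MeasureTheory ProbabilityTheory in
lemma finset_hoeffding {α : Type*} (s : Finset α) (p f : α → ℝ) (hp : ∀ i ∈ s, 0 ≤ p i)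
    (hp1 : ∑ i ∈ s, p i = 1) (c : ℝ) (hf : ∀ i, f i ∈ Set.Icc (-c) c) (t : ℝ) :
    ∑ i ∈ s, p i * Real.exp (t * f i)
      ≤ Real.exp (t * (∑ i ∈ s, p i * f i) + t ^ 2 * c ^ 2 / 2) := by
  letI : MeasurableSpace α := ⊤
  let μ : Measure α := ∑ i ∈ s, ENNReal.ofReal (p i) • Measure.dirac i
  have hμ : IsProbabilityMeasure μ := by
    constructor
    simp only [μ, Measure.coe_finsetSum, Finset.sum_apply, Measure.smul_apply, measure_univ,
      smul_eq_mul, mul_one]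
    rw [← ENNReal.ofReal_sum_of_nonneg hp, hp1, ENNReal.ofReal_one]
  have hint : ∀ g : α → ℝ, ∫ x, g x ∂μ = ∑ i ∈ s, p i * g i := by
    intro g
    simp only [μ]
    rw [integral_finsetSum_measure]
    · refine Finset.sum_congr rfl fun i hi => ?_
      rw [integral_smul_measure, integral_dirac, ENNReal.toReal_ofReal (hp i hi), smul_eq_mul]
    · intro i hi
      exact (integrable_dirac (by simp)).smul_measure ENNReal.ofReal_ne_top
  have hm : AEMeasurable f μ := measurable_from_top.aemeasurable
  have h := (hasSubgaussianMGF_of_mem_Icc hm (ae_of_all μ hf)).mgf_le t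
  rw [mgf, hint, hint] at h
  have e1 : ∑ i ∈ s, p i * Real.exp (t * (f i - ∑ i ∈ s, p i * f i))
      = Real.exp (-(t * ∑ i ∈ s, p i * f i)) * ∑ i ∈ s, p i * Real.exp (t * f i) := by
    rw [Finset.mul_sum]
    refine Finset.sum_congr rfl fun i _ => ?_
    rw [mul_sub, sub_eq_add_neg, Real.exp_add]; ring
  rw [e1] at h
  have e2 : ((‖c - -c‖₊ / 2) ^ 2 : NNReal) * t ^ 2 / 2 = t ^ 2 * c ^ 2 / 2 := by
    push_cast
    rw [Real.norm_eq_abs, div_pow, sq_abs]; ring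
  rw [e2] at h
  rw [Real.exp_add]
  have h3 := mul_le_mul_of_nonneg_left h (Real.exp_pos (t * ∑ i ∈ s, p i * f i)).le
  rwa [← mul_assoc, ← Real.exp_add, add_neg_cancel, Real.exp_zero, one_mul] at h3

lemma step_moment {α : Type*} (F : Finset α) (c : ℝ) (hc : 0 ≤ c) (w w' : α → ℝ)
    (hw : ∀ e ∈ F, |w e - w' e| ≤ 1) (t : ℝ) (ht : 0 ≤ t) :
    ∑ e ∈ F, (Real.exp (-c * w e) / ∑ i ∈ F, Real.exp (-c * w i)) *
      ((Real.exp (-c * w e) / ∑ i ∈ F, Real.exp (-c * w i)) /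
        (Real.exp (-c * w' e) / ∑ i ∈ F, Real.exp (-c * w' i))) ^ t
      ≤ Real.exp ((t + t ^ 2) * c ^ 2 / 2) := by
  rcases F.eq_empty_or_nonempty with rfl | hF
  · simp [Real.exp_nonneg]
  set Z := ∑ i ∈ F, Real.exp (-c * w i) with hZ
  set Z' := ∑ i ∈ F, Real.exp (-c * w' i) with hZ'
  have Zpos : 0 < Z := Finset.sum_pos (fun i _ => Real.exp_pos _) hF
  have Zpos' : 0 < Z' := Finset.sum_pos (fun i _ => Real.exp_pos _) hF
  set p : α → ℝ := fun e => Real.exp (-c * w e) / Z with hp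
  set y : α → ℝ := fun e => if e ∈ F then -c * (w e - w' e) else 0 with hy
  have hy1 : ∀ e ∈ F, y e = -c * (w e - w' e) := fun e he => by simp [hy, he]
  have hyI : ∀ e, y e ∈ Set.Icc (-c) c := by
    intro e
    by_cases he : e ∈ F
    · rw [hy1 e he]
      have := abs_le.1 (hw e he)
      constructor <;> nlinarith
    · simp [hy, he, hc]
  have hp0 : ∀ e ∈ F, 0 ≤ p e := fun e _ => by positivity
  have hp1 : ∑ e ∈ F, p e = 1 := by
    simp only [hp]; rw [← Finset.sum_div]; exact div_self Zpos.ne'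
  have H := finset_hoeffding F p y hp0 hp1 c hyI
  set m := ∑ i ∈ F, p i * y i
  have hneg : ∑ e ∈ F, p e * Real.exp ((-1) * y e) = Z' / Z := by
    rw [hZ', Finset.sum_div]
    refine Finset.sum_congr rfl fun e he => ?_
    rw [hy1 e he]; simp only [hp]
    rw [div_mul_eq_mul_div, ← Real.exp_add]; congr 2; ring
  have hr : ∀ e ∈ F, p e * (p e / (Real.exp (-c * w' e) / Z')) ^ t
      = (p e * Real.exp (t * y e)) * (Z' / Z) ^ t := by
    intro e he
    have : p e / (Real.exp (-c * w' e) / Z') = Real.exp (y e) * (Z' / Z) := by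
      rw [hy1 e he]
      have : -c * (w e - w' e) = -c * w e - -c * w' e := by ring
      rw [this, Real.exp_sub]; simp only [hp]; field_simp
    rw [this, Real.mul_rpow (Real.exp_nonneg _) (by positivity), ← Real.exp_mul, mul_comm (y e) t]
    ring
  change ∑ e ∈ F, p e * (p e / (Real.exp (-c * w' e) / Z')) ^ t ≤ _
  rw [Finset.sum_congr rfl hr, ← Finset.sum_mul]
  have h1 := H t
  have h2 := H (-1)
  rw [hneg] at h2
  have h3 := Real.rpow_le_rpow (by positivity) h2 ht
  rw [← Real.exp_mul] at h3
  calc _ ≤ _ := mul_le_mul h1 h3 (by positivity) (Real.exp_nonneg _)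
    _ = _ := by rw [← Real.exp_add]; congr 1; ring

section
variable {V : Type*} [Fintype V] [DecidableEq V] (G : SimpleGraph V) [Fintype G.edgeSet]

noncomputable def kruskalRuns : ℕ → Finset (Sym2 V) → Finset (List (Sym2 V))
  | 0, _ => {[]}
  | k + 1, T => (kruskalCand G T).biUnion fun e =>
      (kruskalRuns k (insert e T)).image (List.cons e)

lemma mem_kruskalRuns (k : ℕ) (T : Finset (Sym2 V)) (l : List (Sym2 V)) :
    l ∈ kruskalRuns G k T ↔ l.length = k ∧ KruskalFeasible G T l := by
  induction k generalizing T l with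
  | zero =>
    simp only [kruskalRuns, Finset.mem_singleton, List.length_eq_zero_iff]
    constructor
    · rintro rfl; exact ⟨rfl, trivial⟩
    · exact fun h => h.1
  | succ k ih =>
    simp only [kruskalRuns, Finset.mem_biUnion, Finset.mem_image, ih]
    cases l with
    | nil => simp
    | cons e r =>
      simp only [List.cons.injEq, List.length_cons, KruskalFeasible]
      constructor
      · rintro ⟨a, ha, b, ⟨hb, hb2⟩, rfl, rfl⟩
        exact ⟨by omega, ha, hb2⟩
      · rintro ⟨h1, h2, h3⟩
        exact ⟨e, h2, r, ⟨by omega, h3⟩, rfl, rfl⟩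

lemma sum_kruskalRuns_succ (k : ℕ) (T : Finset (Sym2 V)) (f : List (Sym2 V) → ℝ) :
    ∑ l ∈ kruskalRuns G (k + 1) T, f l
      = ∑ e ∈ kruskalCand G T, ∑ l ∈ kruskalRuns G k (insert e T), f (e :: l) := by
  rw [kruskalRuns, Finset.sum_biUnion]
  · refine Finset.sum_congr rfl fun e _ => ?_
    rw [Finset.sum_image]
    intro a _ b _ h
    exact (List.cons.inj h).2
  · intro a _ b _ hab
    rw [Function.onFun, Finset.disjoint_left]
    intro l h1 h2
    obtain ⟨x, _, rfl⟩ := Finset.mem_image.1 h1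
    obtain ⟨y, _, h⟩ := Finset.mem_image.1 h2
    exact hab (List.cons.inj h).1.symm

lemma kruskalSeqProb_nonneg (c : ℝ) (W : Sym2 V → ℝ) (l : List (Sym2 V)) (T : Finset (Sym2 V)) :
    0 ≤ kruskalSeqProb G c W T l := by
  induction l generalizing T with
  | nil => simp [kruskalSeqProb]
  | cons e r ih =>
    rw [kruskalSeqProb]
    exact mul_nonneg (div_nonneg (Real.exp_nonneg _)
      (Finset.sum_nonneg fun _ _ => Real.exp_nonneg _)) (ih _)

lemma kruskalSeqProb_pos (c : ℝ) (W : Sym2 V → ℝ) (l : List (Sym2 V)) (T : Finset (Sym2 V))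
    (h : KruskalFeasible G T l) : 0 < kruskalSeqProb G c W T l := by
  induction l generalizing T with
  | nil => simp [kruskalSeqProb]
  | cons e r ih =>
    rw [kruskalSeqProb]
    exact mul_pos (div_pos (Real.exp_pos _)
      (Finset.sum_pos (fun _ _ => Real.exp_pos _) ⟨e, h.1⟩)) (ih _ h.2)

lemma runs_moment (c : ℝ) (hc : 0 ≤ c) (W W' : Sym2 V → ℝ)
    (hW : ∀ e ∈ G.edgeSet, |W e - W' e| ≤ 1) (t : ℝ) (ht : 0 ≤ t) (k : ℕ)
    (T : Finset (Sym2 V)) :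
    ∑ l ∈ kruskalRuns G k T, kruskalSeqProb G c W T l *
        (kruskalSeqProb G c W T l / kruskalSeqProb G c W' T l) ^ t
      ≤ Real.exp (k * ((t + t ^ 2) * (c / 2) ^ 2 / 2)) := by
  induction k generalizing T with
  | zero => simp [kruskalRuns, kruskalSeqProb]
  | succ k ih =>
    rw [sum_kruskalRuns_succ]
    have hs := step_moment (kruskalCand G T) (c / 2) (by positivity) W W'
      (fun e he => hW e (by
        have := (Finset.mem_filter.1 he).1
        simpa using this)) t ht
    have hZ : ∀ U : Sym2 V → ℝ, 0 ≤ ∑ e' ∈ kruskalCand G T, Real.exp (-(c / 2) * U e') :=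
      fun U => Finset.sum_nonneg fun _ _ => Real.exp_nonneg _
    have hb : ((k + 1 : ℕ) : ℝ) * ((t + t ^ 2) * (c / 2) ^ 2 / 2)
        = (t + t ^ 2) * (c / 2) ^ 2 / 2 + k * ((t + t ^ 2) * (c / 2) ^ 2 / 2) := by
      push_cast; ring
    rw [hb, Real.exp_add]
    refine le_trans ?_ (mul_le_mul_of_nonneg_right hs (Real.exp_nonneg _))
    rw [Finset.sum_mul]
    refine Finset.sum_le_sum fun e he => ?_
    refine le_trans (le_of_eq ?_) (mul_le_mul_of_nonneg_left (ih (insert e T)) ?_)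
    · rw [Finset.mul_sum]
      refine Finset.sum_congr rfl fun l _ => ?_
      simp only [kruskalSeqProb]
      rw [mul_div_mul_comm, Real.mul_rpow]
      · ring
      · exact div_nonneg (div_nonneg (Real.exp_nonneg _) (hZ _))
          (div_nonneg (Real.exp_nonneg _) (hZ _))
      · exact div_nonneg (kruskalSeqProb_nonneg _ _ _ _ _) (kruskalSeqProb_nonneg _ _ _ _ _)
    · exact mul_nonneg (div_nonneg (Real.exp_nonneg _) (hZ _)) (Real.rpow_nonneg
        (div_nonneg (div_nonneg (Real.exp_nonneg _) (hZ _))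
          (div_nonneg (Real.exp_nonneg _) (hZ _))) _)

lemma runs_dp (c : ℝ) (hc : 0 ≤ c) (W W' : Sym2 V → ℝ)
    (hW : ∀ e ∈ G.edgeSet, |W e - W' e| ≤ 1) (t : ℝ) (ht : 0 ≤ t) (k : ℕ) (ε : ℝ)
    (T : Finset (Sym2 V)) (A : Finset (List (Sym2 V))) (hA : A ⊆ kruskalRuns G k T) :
    ∑ l ∈ A, kruskalSeqProb G c W T l ≤ Real.exp ε * ∑ l ∈ A, kruskalSeqProb G c W' T l
      + Real.exp (-(t * ε) + k * ((t + t ^ 2) * (c / 2) ^ 2 / 2)) := by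
  have hpt : ∀ l ∈ A, kruskalSeqProb G c W T l ≤ Real.exp ε * kruskalSeqProb G c W' T l
      + Real.exp (-(t * ε)) * (kruskalSeqProb G c W T l *
        (kruskalSeqProb G c W T l / kruskalSeqProb G c W' T l) ^ t) := by
    intro l hl
    have hf := ((mem_kruskalRuns G k T l).1 (hA hl)).2
    have hP := kruskalSeqProb_pos G c W l T hf
    have hQ := kruskalSeqProb_pos G c W' l T hf
    set P := kruskalSeqProb G c W T l
    set Q := kruskalSeqProb G c W' T l
    by_cases h : P ≤ Real.exp ε * Q
    · have : 0 ≤ Real.exp (-(t * ε)) * (P * (P / Q) ^ t) := by positivity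
      linarith
    · push Not at h
      have h1 : Real.exp ε ≤ P / Q := by rw [le_div_iff₀ hQ]; exact h.le
      have h2 := Real.rpow_le_rpow (Real.exp_nonneg _) h1 ht
      rw [← Real.exp_mul] at h2
      have h3 : P ≤ Real.exp (-(t * ε)) * (P * (P / Q) ^ t) := by
        calc P = Real.exp (-(t * ε)) * (P * Real.exp (ε * t)) := by
              rw [mul_left_comm, ← Real.exp_add, mul_comm ε t, neg_add_cancel, Real.exp_zero,
                mul_one]
          _ ≤ _ := by gcongr
      have : 0 ≤ Real.exp ε * Q := by positivity
      linarith
  refine (Finset.sum_le_sum hpt).trans ?_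
  rw [Finset.sum_add_distrib, ← Finset.mul_sum, ← Finset.mul_sum, Real.exp_add]
  gcongr
  refine le_trans ?_ (runs_moment G c hc W W' hW t ht k T)
  refine Finset.sum_le_sum_of_subset_of_nonneg hA fun l _ _ => ?_
  exact mul_nonneg (kruskalSeqProb_nonneg _ _ _ _ _) (Real.rpow_nonneg
    (div_nonneg (kruskalSeqProb_nonneg _ _ _ _ _) (kruskalSeqProb_nonneg _ _ _ _ _)) _)

lemma pmf_eq (c : ℝ) (n : ℕ) (W : Sym2 V → ℝ) (M : PMF (Finset (Sym2 V)))
    (hM : ∀ (T : Finset (Sym2 V)),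
      M T = ∑' l : {l : List (Sym2 V) //
              l.length = n - 1 ∧ KruskalFeasible G ∅ l ∧ l.toFinset = T},
            ENNReal.ofReal (kruskalSeqProb G c W ∅ (l : List (Sym2 V))))
    (S : Set (Finset (Sym2 V))) :
    M.toOuterMeasure S = ENNReal.ofReal
      (∑ l ∈ (kruskalRuns G (n - 1) ∅).filter (fun l => l.toFinset ∈ S),
        kruskalSeqProb G c W ∅ l) := by
  rw [PMF.toOuterMeasure_apply, tsum_fintype,
    ENNReal.ofReal_sum_of_nonneg (fun l _ => kruskalSeqProb_nonneg _ _ _ _ _)]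
  have hT : ∀ T, M T = ∑ l ∈ kruskalRuns G (n - 1) ∅,
      if l.toFinset = T then ENNReal.ofReal (kruskalSeqProb G c W ∅ l) else 0 := by
    intro T
    rw [hM T, ← Finset.sum_filter]
    rw [← Finset.tsum_subtype]
    refine (Equiv.tsum_eq (Equiv.subtypeEquivRight fun l => ?_)
      (fun l : {l // l ∈ (kruskalRuns G (n - 1) ∅).filter (fun l => l.toFinset = T)} =>
        ENNReal.ofReal (kruskalSeqProb G c W ∅ (l : List (Sym2 V)))))
    rw [Finset.mem_filter, mem_kruskalRuns, and_assoc]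
  simp only [Set.indicator_apply, hT]
  rw [Finset.sum_filter]
  calc _ = ∑ T, ∑ l ∈ kruskalRuns G (n - 1) ∅, (if l.toFinset = T then
        (if T ∈ S then ENNReal.ofReal (kruskalSeqProb G c W ∅ l) else 0) else 0) := by
        refine Finset.sum_congr rfl fun T _ => ?_
        by_cases h : T ∈ S <;> simp [h]
    _ = _ := by
        rw [Finset.sum_comm]
        refine Finset.sum_congr rfl fun l _ => ?_
        rw [Finset.sum_ite_eq]; simp
end

/-- Let `G` be a finite connected graph with `n ≥ 2` vertices, `ε, δ > 0`,
`ρ = (√(ε + ln(1/δ)) − √(ln(1/δ)))²` and `ε' = √(2ρ/(n−1))`.  The private Kruskal mechanism —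
which iterates `n−1` times, each round sampling an edge of the current candidate set with
probability proportional to `exp(−(ε'/2)·w_e)`, adding it to `T` and discarding cycle-creating
edges, and finally outputs `T` (so that the probability of outputting a set `T` is the sum,
over the feasible selection orders of length `n−1` realizing `T`, of the products of the
per-round exponential-mechanism probabilities) — is `(ε, δ)`-differentially private under
`ℓ∞`-neighboring with sensitivity `1`. -/
theorem stmt_6 {V : Type*} [Fintype V] [DecidableEq V]
    (G : SimpleGraph V) [Fintype G.edgeSet] (hG : G.Connected)
    (n : ℕ) (hn : n = Fintype.card V) (hn2 : 2 ≤ n)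
    (ε δ ρ ε' : ℝ) (hε : 0 < ε) (hδ : 0 < δ)
    (hρ : ρ = (Real.sqrt (ε + Real.log (1 / δ)) - Real.sqrt (Real.log (1 / δ))) ^ 2)
    (hε' : ε' = Real.sqrt (2 * ρ / ((n : ℝ) - 1)))
    (M : (Sym2 V → ℝ) → PMF (Finset (Sym2 V)))
    (hM : ∀ (W : Sym2 V → ℝ) (T : Finset (Sym2 V)),
      (M W) T
        = ∑' l : {l : List (Sym2 V) //
              l.length = n - 1 ∧ KruskalFeasible G ∅ l ∧ l.toFinset = T},
            ENNReal.ofReal (kruskalSeqProb G ε' W ∅ (l : List (Sym2 V)))) :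
    ∀ W W' : Sym2 V → ℝ, (∀ e ∈ G.edgeSet, |W e - W' e| ≤ 1) →
      ∀ S : Set (Finset (Sym2 V)),
        (M W).toOuterMeasure S
          ≤ ENNReal.ofReal (Real.exp ε) * (M W').toOuterMeasure S + ENNReal.ofReal δ := by
  intro W W' hW S
  by_cases hδ1 : 1 ≤ δ
  · refine le_trans ?_ le_add_self
    refine le_trans ?_ (ENNReal.ofReal_le_ofReal hδ1)
    rw [ENNReal.ofReal_one, PMF.toOuterMeasure_apply, ← (M W).tsum_coe]
    exact ENNReal.tsum_le_tsum fun T => Set.indicator_le_self _ _ _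
  push Not at hδ1
  rw [pmf_eq G ε' n W (M W) (hM W) S, pmf_eq G ε' n W' (M W') (hM W') S,
    ← ENNReal.ofReal_mul (Real.exp_nonneg _), ← ENNReal.ofReal_add
      (mul_nonneg (Real.exp_nonneg _) (Finset.sum_nonneg fun l _ =>
        kruskalSeqProb_nonneg _ _ _ _ _)) hδ.le]
  refine ENNReal.ofReal_le_ofReal ?_
  have hL : 0 < Real.log (1 / δ) := Real.log_pos (by rw [lt_div_iff₀ hδ]; linarith)
  have hLδ : Real.log (1 / δ) = - Real.log δ := by rw [one_div, Real.log_inv]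
  set L := Real.log (1 / δ)
  set s := Real.sqrt L
  set r := Real.sqrt (ε + L) - s
  have hs : 0 ≤ s := Real.sqrt_nonneg _
  have hs2 : s ^ 2 = L := Real.sq_sqrt hL.le
  have hr : 0 < r := sub_pos.2 (Real.sqrt_lt_sqrt hL.le (by linarith))
  have hε2 : ε = r ^ 2 + 2 * r * s := by
    have h1 : (r + s) ^ 2 = ε + L := by
      rw [sub_add_cancel]; exact Real.sq_sqrt (by linarith)
    nlinarith
  have hc : 0 ≤ ε' := by rw [hε']; exact Real.sqrt_nonneg _
  have hn1 : (0 : ℝ) < n - 1 := by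
    have : (2 : ℝ) ≤ n := by exact_mod_cast hn2
    linarith
  have hc2 : ((n - 1 : ℕ) : ℝ) * ε' ^ 2 = 2 * r ^ 2 := by
    rw [hε', Real.sq_sqrt (by rw [hρ]; positivity), Nat.cast_sub (by omega), Nat.cast_one, hρ]
    field_simp
  have key := runs_dp G ε' hc W W' hW (s / r) (by positivity) (n - 1) ε ∅ _
    (Finset.filter_subset (fun l => l.toFinset ∈ S) _)
  refine key.trans (add_le_add le_rfl ?_)
  rw [← Real.exp_log hδ]
  apply Real.exp_le_exp.2
  have e1 : ((n - 1 : ℕ) : ℝ) * ((s / r + (s / r) ^ 2) * (ε' / 2) ^ 2 / 2)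
      = (s * r + s ^ 2) / 4 := by
    calc _ = (((n - 1 : ℕ) : ℝ) * ε' ^ 2) * (s / r + (s / r) ^ 2) / 8 := by ring
      _ = _ := by rw [hc2]; field_simp; ring
  have e2 : s / r * ε = s * r + 2 * s ^ 2 := by rw [hε2]; field_simp
  rw [e1, e2]
  nlinarith [mul_nonneg hs hr.le]
end

section
/- Let n ≥ 1700 be an integer, let c ≥ 2 ln(2 ln n) + 2, and set p = (c + ln n)/n, assuming p ≤ 1. Then Σ_{k=2}^{⌊n/2⌋} C(n, k) · k^{k−2} · p^{k−1} · (1−p)^{k(n−k)} ≤ 2/n, where C(n, k) denotes the binomial coefficient. (In particular, in the Erdős–Rényi random graph G(n, p), the expected number of connected components of size k between 2 and n/2, which is at most C(n,k)·k^{k−2}·p^{k−1}·(1−p)^{k(n−k)} for each such k, sums to at most 2/n.) -/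
lemma aux_L (n : ℕ) (hn : 1700 ≤ n) :
    32 / 3 * Real.log 2 ≤ Real.log n := by
  have h2 : Real.log ((2:ℝ)^32) ≤ Real.log ((n:ℝ)^3) := by
    apply Real.log_le_log (by positivity)
    have : (1700:ℝ) ≤ n := by exact_mod_cast hn
    calc (2:ℝ)^32 ≤ 1700^3 := by norm_num
      _ ≤ _ := by gcongr
  rw [Real.log_pow, Real.log_pow] at h2
  push_cast at h2
  linarith

lemma log_tangent (x a : ℝ) (hx : 0 < x) (ha : 0 < a) :
    Real.log x ≤ Real.log a + x / a - 1 := by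
  have := Real.log_le_sub_one_of_pos (div_pos hx ha)
  rw [Real.log_div hx.ne' ha.ne'] at this
  linarith

lemma aux_2L (L : ℝ) (h : 32 / 3 * Real.log 2 ≤ L) : 2 * Real.log (2 * L) + 2 ≤ L := by
  have h2 := Real.log_two_gt_d9
  have h3 := log_tangent (2 * L) 16 (by linarith) (by norm_num)
  have h4 : Real.log 16 = 4 * Real.log 2 := by
    rw [show (16:ℝ) = 2^4 by norm_num, Real.log_pow]; norm_num
  linarith

lemma aux_A (L x : ℝ) (h : 32 / 3 * Real.log 2 ≤ L)
    (hx : L + 2 * Real.log (2 * L) + 2 ≤ x) :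
    1 + Real.log x - x / 2 ≤ - (L / 2) ∧ L + 2 ≤ x := by
  have h2 := Real.log_two_gt_d9
  have h0 := aux_2L L h
  have hl : 0 ≤ Real.log (2 * L) := Real.log_nonneg (by linarith)
  refine ⟨?_, by linarith⟩
  have h3 := log_tangent x (2 * L) (by linarith) (by linarith)
  set l := Real.log (2 * L)
  have hL : 7 < L := by linarith
  have key : x / (2 * L) ≤ x / 2 - L / 2 - l := by
    rw [div_le_iff₀ (by linarith)]
    nlinarith [mul_nonneg (sub_nonneg.2 hx) (by linarith : 0 ≤ L - 1)]
  linarith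

lemma aux_choose (n k : ℕ) (hk : 1 ≤ k) :
    (n.choose k : ℝ) * (k : ℝ) ^ (k - 2) ≤ (n : ℝ) ^ k * Real.exp k := by
  have h1 : (n.choose k : ℝ) ≤ (n : ℝ) ^ k / k.factorial := Nat.choose_le_pow_div k n
  have h2 : (k : ℝ) ^ k / k.factorial ≤ Real.exp k := Real.pow_div_factorial_le_exp _ (by positivity) k
  have hk1 : (1:ℝ) ≤ k := by exact_mod_cast hk
  have h3 : (k : ℝ) ^ (k - 2) ≤ (k : ℝ) ^ k := pow_le_pow_right₀ hk1 (by omega)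
  calc _ ≤ (n : ℝ) ^ k / k.factorial * (k : ℝ) ^ k := by gcongr
    _ = (n : ℝ) ^ k * ((k : ℝ) ^ k / k.factorial) := by ring
    _ ≤ _ := by gcongr

lemma aux_sum (m : ℕ) : ∑ k ∈ Finset.Icc 2 m, (1 / 2 : ℝ) ^ k ≤ 1 / 2 := by
  have : ∀ m : ℕ, ∑ k ∈ Finset.Icc 2 (m + 1), (1 / 2 : ℝ) ^ k = 1 / 2 - (1 / 2) ^ (m + 1) := by
    intro m
    induction m with
    | zero => norm_num
    | succ j ih => rw [Finset.sum_Icc_succ_top (by omega), ih]; ring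
  rcases m with _ | m
  · norm_num
  · rw [this]; have : (0:ℝ) < (1/2)^(m+1) := by positivity
    linarith

lemma aux_term (n k : ℕ) (hn : 1 ≤ n) (hk : 1 ≤ k) (hkn : k ≤ n) (x p : ℝ) (hx : 0 < x)
    (hp : p = x / n) (hp1 : p ≤ 1) :
    (n.choose k : ℝ) * (k : ℝ) ^ (k - 2) * p ^ (k - 1) * (1 - p) ^ (k * (n - k))
      ≤ n / x * Real.exp (k * (1 + Real.log x - x * (1 - k / n))) := by
  have hn0 : (0:ℝ) < n := by exact_mod_cast hn
  have hp0 : 0 < p := by rw [hp]; positivity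
  have h1 : (1 - p) ^ (k * (n - k)) ≤ Real.exp (-(k * (x * (1 - k / n)))) := by
    calc (1 - p) ^ (k * (n - k)) ≤ (Real.exp (-p)) ^ (k * (n - k)) := by
          apply pow_le_pow_left₀ (by linarith)
          exact Real.one_sub_le_exp_neg p
      _ = _ := by
          rw [← Real.exp_nat_mul]
          push_cast [Nat.cast_sub hkn]
          rw [hp]; congr 1; field_simp
  have h2 : p ^ (k - 1) * (n:ℝ) ^ k = n / x * x ^ k := by
    obtain ⟨j, rfl⟩ : ∃ j, k = j + 1 := ⟨k - 1, by omega⟩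
    rw [hp, Nat.add_sub_cancel, div_pow, pow_succ, pow_succ]; field_simp
  calc _ ≤ ((n : ℝ) ^ k * Real.exp k) * p ^ (k - 1) * Real.exp (-(k * (x * (1 - k / n)))) := by
        have := aux_choose n k hk
        have h1' : 0 ≤ (1 - p) ^ (k * (n - k)) := pow_nonneg (by linarith) _
        gcongr
    _ = (p ^ (k - 1) * (n:ℝ) ^ k) * (Real.exp k * Real.exp (-(k * (x * (1 - k / n))))) := by ring
    _ = n / x * (Real.exp (k * Real.log x) * (Real.exp k * Real.exp (-(k * (x * (1 - k / n)))))) := by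
        rw [h2, Real.exp_nat_mul, Real.exp_log hx]; ring
    _ = _ := by
        rw [← Real.exp_add, ← Real.exp_add]; congr 2; ring

/-- Let `n ≥ 1700` be an integer, `c ≥ 2 ln(2 ln n) + 2`, and
`p = (c + ln n)/n` with `p ≤ 1`.  Then
`Σ_{k=2}^{⌊n/2⌋} C(n,k) · k^{k−2} · p^{k−1} · (1−p)^{k(n−k)} ≤ 2/n`.
(In the Erdős–Rényi random graph `G(n, p)`, this sum bounds the expected number of
connected components of size between `2` and `n/2`.) -/
theorem stmt_8 (n : ℕ) (hn : 1700 ≤ n) (c : ℝ)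
    (hc : 2 * Real.log (2 * Real.log n) + 2 ≤ c)
    (p : ℝ) (hp : p = (c + Real.log n) / n) (hp1 : p ≤ 1) :
    ∑ k ∈ Finset.Icc 2 (n / 2),
        (n.choose k : ℝ) * (k : ℝ) ^ (k - 2) * p ^ (k - 1) * (1 - p) ^ (k * (n - k))
      ≤ 2 / n := by
  have hnR : (1700:ℝ) ≤ n := by exact_mod_cast hn
  have hn0 : (0:ℝ) < n := by linarith
  have hL := aux_L n hn
  have hlog2 := Real.log_two_gt_d9
  have hlog2' := Real.log_two_lt_d9
  have hLn : 3 * (Real.log n + 2) ≤ n := by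
    have := log_tangent n 4 hn0 (by norm_num)
    have h4 : Real.log 4 = 2 * Real.log 2 := by
      rw [show (4:ℝ) = 2^2 by norm_num, Real.log_pow]; norm_num
    linarith
  have hexpL : Real.exp (Real.log n) = n := Real.exp_log hn0
  set L := Real.log n with hLdef
  obtain ⟨x, hx⟩ : ∃ x, x = c + L := ⟨_, rfl⟩
  rw [← hx] at hp
  obtain ⟨hA, hB⟩ := aux_A L x hL (by linarith)
  have hx4 : 4 ≤ x := by linarith
  have hmain : ∀ k ∈ Finset.Icc 2 (n / 2),
      (n.choose k : ℝ) * (k : ℝ) ^ (k - 2) * p ^ (k - 1) * (1 - p) ^ (k * (n - k))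
        ≤ 4 / n * (1 / 2) ^ k := by
    intro k hk
    rw [Finset.mem_Icc] at hk
    obtain ⟨hk2, hkn⟩ := hk
    have hkn' : 2 * k ≤ n := by omega
    have hkR : (2:ℝ) * k ≤ n := by exact_mod_cast hkn'
    have hk2R : (2:ℝ) ≤ k := by exact_mod_cast hk2
    refine (aux_term n k (by omega) (by omega) (by omega) x p (by linarith) hp hp1).trans ?_
    have hE : Real.exp (k * (1 + Real.log x - x * (1 - k / n)))
        ≤ Real.exp (-(2 * L)) * Real.exp (-((k - 4) * Real.log 2)) := by
      rw [← Real.exp_add]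
      apply Real.exp_le_exp.2
      by_cases h4 : 4 ≤ k
      · have h4R : (4:ℝ) ≤ k := by exact_mod_cast h4
        have hd : (k:ℝ) / n ≤ 1 / 2 := by rw [div_le_iff₀ hn0]; linarith
        have h5 : 1 + Real.log x - x * (1 - k / n) ≤ - (L / 2) := by nlinarith
        have h6 : (k:ℝ) * (1 + Real.log x - x * (1 - k / n)) ≤ k * (-(L / 2)) := by gcongr
        nlinarith [mul_nonneg (by linarith : (0:ℝ) ≤ k - 4) (by linarith : 0 ≤ L / 2 - Real.log 2)]
      · have h3R : (k:ℝ) ≤ 3 := by exact_mod_cast (by omega : k ≤ 3)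
        have hd : (k:ℝ) / n ≤ 3 / n := by gcongr
        have h7 : 3 / (n:ℝ) * (L + 2) ≤ 1 := by
          rw [div_mul_eq_mul_div, div_le_one hn0]; exact hLn
        have h8 : 3 / (n:ℝ) ≤ 1 / 2 := by rw [div_le_iff₀ hn0]; linarith
        have h9 : (L + 2) * (1 / 2 - 3 / n) ≤ x * (1 / 2 - 3 / n) := by
          apply mul_le_mul_of_nonneg_right hB; linarith
        have h10 : x * (1 / 2 - 3 / n) ≤ x * (1 / 2 - k / n) := by
          apply mul_le_mul_of_nonneg_left _ (by linarith); linarith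
        have h5 : 1 + Real.log x - x * (1 - k / n) ≤ - L := by linarith
        have h6 : (k:ℝ) * (1 + Real.log x - x * (1 - k / n)) ≤ k * (-L) := by gcongr
        nlinarith [mul_nonneg (by linarith : (0:ℝ) ≤ k - 2) (by linarith : 0 ≤ L - Real.log 2)]
    have e1 : Real.exp (-(2 * L)) = 1 / (n:ℝ) ^ 2 := by
      rw [Real.exp_neg, two_mul, Real.exp_add, hexpL]; field_simp
    have e2 : Real.exp (-((k - 4) * Real.log 2)) = 16 * (1 / 2 : ℝ) ^ k := by
      rw [show -(((k:ℝ) - 4) * Real.log 2) = ((4:ℕ):ℝ) * Real.log 2 + k * (-Real.log 2) by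
        push_cast; ring, Real.exp_add, Real.exp_nat_mul, Real.exp_nat_mul, Real.exp_neg,
        Real.exp_log (by norm_num)]
      norm_num
    rw [e1, e2] at hE
    calc _ ≤ n / x * (1 / (n:ℝ) ^ 2 * (16 * (1 / 2 : ℝ) ^ k)) := by gcongr
      _ ≤ n / 4 * (1 / (n:ℝ) ^ 2 * (16 * (1 / 2 : ℝ) ^ k)) := by gcongr
      _ = _ := by field_simp; norm_num
  calc _ ≤ ∑ k ∈ Finset.Icc 2 (n / 2), 4 / (n:ℝ) * (1 / 2) ^ k := Finset.sum_le_sum hmain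
    _ = 4 / n * ∑ k ∈ Finset.Icc 2 (n / 2), (1 / 2 : ℝ) ^ k := by rw [Finset.mul_sum]
    _ ≤ 4 / n * (1 / 2) := by gcongr; exact aux_sum _
    _ = _ := by ring
end
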